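/- Fix N ≥ 1, d ≥ 1 and κ > 0, and let Z₀ = (z₁,…,z_N) ∈ (ℝ^d)^N. For each i = 1,…,N let Σ_i ∈ ℝ^{d×d} be symmetric positive semidefinite and let l_i^1,…,l_i^d ∈ ℝ^d satisfy Σ_{j=1}^{d} l_i^j (l_i^j)ᵀ = (Nd + κ)·Σ_i. Define the sigma points: Z^{0,0} = Z₀ with weight w^{0,0} = κ/(κ + Nd); and for i = 1,…,N and j = 1,…,d, Z^{i,j} (resp. Z^{i,j+d}) is obtained from Z₀ by replacing its i-th block z_i with z_i + l_i^j (resp. z_i − l_i^j), each with weight 1/(2(κ + Nd)). Let δZ ∈ ℝ^{Nd} be a centered Gaussian random vector whose blocks δz_i ∈ ℝ^d are independent with covariance matrices Σ_i (i.e., δz_i = L_i ξ_i where L_i L_iᵀ = Σ_i and all coordinates of all ξ_i are i.i.d. standard normal). Then for every polynomial function g: ℝ^{Nd} → ℝ of total degree at most 3, the weighted sigma-point sum equals the exact Gaussian expectation: w^{0,0}·g(Z^{0,0}) + Σ_{i=1}^{N} Σ_{j=1}^{2d} (1/(2(κ+Nd)))·g(Z^{i,j}) = E[g(Z₀ + δZ)].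 -/

import Mathlib

open Matrix MeasureTheory ProbabilityTheory

noncomputable section

/-- Deviation coordinate attached to an optional index (`none` is the zero deviation). -/
def utDev {ι : Type*} (x : ι → ℝ) : Option ι → ℝ
  | none => 0
  | some p => x p

/-- Affine factor: coordinate of the centre, or the constant one. -/
def utCen {ι : Type*} (x : ι → ℝ) : Option ι → ℝ
  | none => 1
  | some p => x p

/-- Covariance between optional indices. -/
def utCov {N d : ℕ} (Cov : Fin N → Matrix (Fin d) (Fin d) ℝ) :
    Option (Fin N × Fin d) → Option (Fin N × Fin d) → ℝ
  | some p, some q => if p.1 = q.1 then Cov p.1 p.2 q.2 else 0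
  | _, _ => 0

lemma ut_monomial {ι : Type*} [DecidableEq ι] (s : ι →₀ ℕ) (hs : (s.sum fun _ e => e) ≤ 3) :
    ∃ o₁ o₂ o₃ : Option ι, ∀ z x : ι → ℝ,
      (s.prod fun n e => (z n + x n) ^ e) =
        (utCen z o₁ + utDev x o₁) * (utCen z o₂ + utDev x o₂) * (utCen z o₃ + utDev x o₃) := by
  obtain ⟨m, rfl⟩ : ∃ m : Multiset ι, Multiset.toFinsupp m = s :=
    ⟨Finsupp.toMultiset s, by simp⟩
  have hcard : Multiset.card m ≤ 3 := by
    have h := Finsupp.card_toMultiset (Multiset.toFinsupp m)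
    rw [Multiset.toFinsupp_toMultiset] at h
    rw [h]
    exact hs
  have key : ∀ z x : ι → ℝ, ((Multiset.toFinsupp m).prod fun n e => (z n + x n) ^ e)
      = (m.map fun n => z n + x n).prod := by
    intro z x
    have := Finsupp.prod_toMultiset ((Multiset.toFinsupp m).mapDomain fun n => z n + x n)
    rw [← Finsupp.toMultiset_map, Multiset.toFinsupp_toMultiset] at this
    rw [this, Finsupp.prod_mapDomain_index (by simp) (by intros; rw [pow_add])]
  have h : Multiset.card m = 0 ∨ Multiset.card m = 1 ∨ Multiset.card m = 2 ∨
    Multiset.card m = 3 := by omega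
  rcases h with h | h | h | h
  · rw [Multiset.card_eq_zero] at h
    subst h
    exact ⟨none, none, none, fun z x => by rw [key]; simp [utCen, utDev]⟩
  · obtain ⟨a, rfl⟩ := Multiset.card_eq_one.1 h
    exact ⟨some a, none, none, fun z x => by rw [key]; simp [utCen, utDev]⟩
  · obtain ⟨a, b, rfl⟩ := Multiset.card_eq_two.1 h
    exact ⟨some a, some b, none, fun z x => by rw [key]; simp [utCen, utDev]⟩
  · obtain ⟨a, b, c, rfl⟩ := Multiset.card_eq_three.1 h
    exact ⟨some a, some b, some c, fun z x => by
      rw [key]; simp [utCen, utDev, mul_assoc]⟩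

instance ut_negInv : (gaussianReal 0 1).IsNegInvariant := ⟨by
  rw [Measure.neg]
  exact (gaussianReal_map_neg).trans (by simp)⟩

/-- The standard Gaussian law on blocks. -/
abbrev utMu (N d : ℕ) : Measure (Fin N → Fin d → ℝ) :=
  Measure.pi fun _ => Measure.pi fun _ => gaussianReal 0 1

lemma ut_mp (N d : ℕ) (i : Fin N) (k : Fin d) :
    MeasurePreserving (fun ξ : Fin N → Fin d → ℝ => ξ i k) (utMu N d) (gaussianReal 0 1) :=
  (measurePreserving_eval (fun _ : Fin d => gaussianReal 0 1) k).comp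
    (measurePreserving_eval (fun _ : Fin N => Measure.pi fun _ : Fin d => gaussianReal 0 1) i)

lemma ut_memLp (N d : ℕ) (i : Fin N) (k : Fin d) (p : NNReal) :
    MemLp (fun ξ : Fin N → Fin d → ℝ => ξ i k) p (utMu N d) :=
  (memLp_id_gaussianReal (μ := 0) (v := 1) p).comp_measurePreserving (ut_mp N d i k)

lemma ut_mean (N d : ℕ) (i : Fin N) (k : Fin d) :
    ∫ ξ : Fin N → Fin d → ℝ, ξ i k ∂(utMu N d) = 0 := by
  have h := integral_map (μ := utMu N d) (ut_mp N d i k).measurable.aemeasurable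
    (f := fun x : ℝ => x) (by fun_prop)
  rw [(ut_mp N d i k).map_eq, integral_id_gaussianReal] at h
  exact h.symm

lemma ut_second (N d : ℕ) (i j : Fin N) (k m : Fin d) :
    ∫ ξ : Fin N → Fin d → ℝ, ξ i k * ξ j m ∂(utMu N d) = if i = j ∧ k = m then 1 else 0 := by
  by_cases hij : i = j
  · subst hij
    by_cases hkm : k = m
    · subst hkm
      simp only [and_self, if_true]
      have h := integral_map (μ := utMu N d) (ut_mp N d i k).measurable.aemeasurable
        (f := fun x : ℝ => x * x) (by fun_prop)
      rw [(ut_mp N d i k).map_eq] at h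
      rw [← h]
      have hv := variance_id_gaussianReal (μ := 0) (v := 1)
      rw [variance_of_integral_eq_zero (by fun_prop) (by simp)] at hv
      simpa [pow_two] using hv
    · simp only [hkm, and_false, if_false]
      have mp := measurePreserving_eval
        (fun _ : Fin N => Measure.pi fun _ : Fin d => gaussianReal 0 1) i
      have h := integral_map (μ := utMu N d) mp.measurable.aemeasurable
        (f := fun x : Fin d → ℝ => x k * x m) (by fun_prop)
      rw [mp.map_eq] at h
      refine h.symm.trans ?_
      have hI := (iIndepFun_pi (μ := fun _ : Fin d => gaussianReal 0 1)
        (X := fun _ (x : ℝ) => x) (fun _ => by fun_prop)).indepFun hkm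
      rw [hI.integral_fun_mul_eq_mul_integral (measurable_pi_apply k).aestronglyMeasurable
        (measurable_pi_apply m).aestronglyMeasurable]
      have mp' := measurePreserving_eval (fun _ : Fin d => gaussianReal 0 1) k
      have h' := integral_map (μ := Measure.pi fun _ : Fin d => gaussianReal 0 1)
        mp'.measurable.aemeasurable (f := fun x : ℝ => x) (by fun_prop)
      rw [mp'.map_eq, integral_id_gaussianReal] at h'
      simp only [Function.eval] at h'
      rw [← h', zero_mul]
  · simp only [hij, false_and, if_false]
    have hI := ((iIndepFun_pi (μ := fun _ : Fin N => Measure.pi fun _ : Fin d => gaussianReal 0 1)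
        (X := fun _ (x : Fin d → ℝ) => x) (fun _ => by fun_prop)).indepFun hij).comp
        (φ := fun x : Fin d → ℝ => x k) (ψ := fun x : Fin d → ℝ => x m)
        (_mγ := Real.measurableSpace) (_mγ' := Real.measurableSpace) (by fun_prop) (by fun_prop)
    have := hI.integral_fun_mul_eq_mul_integral (ut_mp N d i k).measurable.aestronglyMeasurable
      (ut_mp N d j m).measurable.aestronglyMeasurable
    simp only [Function.comp_def] at this
    refine this.trans ?_
    have h0 := ut_mean N d i k
    unfold utMu at h0
    rw [h0, zero_mul]

lemma ut_expect {N d : ℕ} (Cov L : Fin N → Matrix (Fin d) (Fin d) ℝ)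
    (hL : ∀ i, L i * (L i)ᵀ = Cov i) (a b c : ℝ) (o₁ o₂ o₃ : Option (Fin N × Fin d)) :
    let X : (Fin N → Fin d → ℝ) → Option (Fin N × Fin d) → ℝ :=
      fun ξ => utDev fun p => (L p.1).mulVec (ξ p.1) p.2
    Integrable (fun ξ => (a + X ξ o₁) * (b + X ξ o₂) * (c + X ξ o₃)) (utMu N d) ∧
    ∫ ξ, (a + X ξ o₁) * (b + X ξ o₂) * (c + X ξ o₃) ∂(utMu N d) =
      a * b * c + a * utCov Cov o₂ o₃ + b * utCov Cov o₁ o₃ + c * utCov Cov o₁ o₂ := by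
  intro X
  have hXL : ∀ o (p : NNReal), MemLp (fun ξ => X ξ o) p (utMu N d) := by
    intro o p
    rcases o with _ | q
    · exact MemLp.zero'
    · simp only [X, utDev, Matrix.mulVec, dotProduct]
      exact memLp_finsetSum _ fun k _ => (ut_memLp N d q.1 k p).const_mul _
  have h1 : ∀ o, Integrable (fun ξ => X ξ o) (utMu N d) := fun o =>
    memLp_one_iff_integrable.1 (by simpa using hXL o 1)
  have h2 : ∀ o o', Integrable (fun ξ => X ξ o * X ξ o') (utMu N d) := fun o o' =>
    MemLp.integrable_mul (p := 2) (q := 2) (by simpa using hXL o 2) (by simpa using hXL o' 2)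
  have h44 : ENNReal.HolderTriple 4 4 2 := ⟨by
    rw [← two_mul, show (4:ENNReal) = 2 * 2 by norm_num,
      ENNReal.mul_inv (by simp) (by simp), ← mul_assoc, ENNReal.mul_inv_cancel (by simp) (by simp),
      one_mul]⟩
  have h3 : Integrable (fun ξ => X ξ o₁ * X ξ o₂ * X ξ o₃) (utMu N d) := by
    refine MemLp.integrable_mul (p := 2) (q := 2) ?_ (by simpa using hXL o₃ 2)
    exact MemLp.mul (p := 4) (q := 4) (by simpa using hXL o₂ 4) (by simpa using hXL o₁ 4)
  have hneg : ∀ o ξ, X (-ξ) o = - X ξ o := by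
    intro o ξ
    rcases o with _ | q
    · simp [X, utDev]
    · simp [X, utDev, Matrix.mulVec_neg]
  have inst1 : (Measure.pi fun _ : Fin d => gaussianReal 0 1).IsNegInvariant := inferInstance
  have inst2 : (utMu N d).IsNegInvariant :=
    Measure.pi.isNegInvariant (fun _ : Fin N => Measure.pi fun _ : Fin d => gaussianReal 0 1)
  have e1 : ∀ o, ∫ ξ, X ξ o ∂(utMu N d) = 0 := by
    intro o
    have := integral_neg_eq_self (fun ξ => X ξ o) (utMu N d)
    simp only [hneg, integral_neg] at this
    linarith
  have e3 : ∫ ξ, X ξ o₁ * X ξ o₂ * X ξ o₃ ∂(utMu N d) = 0 := by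
    have := integral_neg_eq_self (fun ξ => X ξ o₁ * X ξ o₂ * X ξ o₃) (utMu N d)
    simp only [hneg, neg_mul, mul_neg, neg_neg, integral_neg] at this
    linarith
  have e2 : ∀ o o', ∫ ξ, X ξ o * X ξ o' ∂(utMu N d) = utCov Cov o o' := by
    intro o o'
    rcases o with _ | p
    · simp [X, utDev, utCov]
    rcases o' with _ | q
    · simp [X, utDev, utCov]
    simp only [X, utDev, utCov, Matrix.mulVec, dotProduct, Finset.sum_mul_sum]
    have hi : ∀ k m, Integrable (fun ξ : Fin N → Fin d → ℝ =>
        L p.1 p.2 k * ξ p.1 k * (L q.1 q.2 m * ξ q.1 m)) (utMu N d) := by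
      intro k m
      refine MemLp.integrable_mul (p := 2) (q := 2) ?_ ?_
      · exact (ut_memLp N d p.1 k 2).const_mul _
      · exact (ut_memLp N d q.1 m 2).const_mul _
    rw [integral_finsetSum _ fun k _ => integrable_finsetSum _ fun m _ => hi k m]
    have : ∀ k m, ∫ ξ : Fin N → Fin d → ℝ,
        L p.1 p.2 k * ξ p.1 k * (L q.1 q.2 m * ξ q.1 m) ∂(utMu N d)
        = L p.1 p.2 k * L q.1 q.2 m * if p.1 = q.1 ∧ k = m then 1 else 0 := by
      intro k m
      rw [← ut_second, ← integral_const_mul]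
      congr 1
      ext ξ
      ring
    simp_rw [integral_finsetSum _ fun m _ => hi _ m, this]
    by_cases h : p.1 = q.1
    · simp [h, ← hL, Matrix.mul_apply]
    · simp [h]
  have hexp : (fun ξ => (a + X ξ o₁) * (b + X ξ o₂) * (c + X ξ o₃)) = fun ξ =>
      (a * b * c + (b * c * X ξ o₁ + a * c * X ξ o₂ + a * b * X ξ o₃)) +
      (a * (X ξ o₂ * X ξ o₃) + b * (X ξ o₁ * X ξ o₃) + c * (X ξ o₁ * X ξ o₂)) +
      X ξ o₁ * X ξ o₂ * X ξ o₃ := by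
    ext ξ; ring
  have i1 := (h1 o₁).const_mul (b * c)
  have i2 := (h1 o₂).const_mul (a * c)
  have i3 := (h1 o₃).const_mul (a * b)
  have j1 := (h2 o₂ o₃).const_mul a
  have j2 := (h2 o₁ o₃).const_mul b
  have j3 := (h2 o₁ o₂).const_mul c
  have i12 := i1.fun_add i2
  have i123 := i12.fun_add i3
  have j12 := j1.fun_add j2
  have j123 := j12.fun_add j3
  have ic : Integrable (fun _ : Fin N → Fin d → ℝ => a * b * c) (utMu N d) := integrable_const _
  have k1 := ic.fun_add i123
  have k2 := k1.fun_add j123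
  rw [hexp]
  refine ⟨k2.fun_add h3, ?_⟩
  rw [integral_add k2 h3, integral_add k1 j123, integral_add ic i123, integral_add i12 i3,
    integral_add i1 i2, integral_add j12 j3, integral_add j1 j2]
  simp only [integral_const_mul, e1, e2, e3, integral_const]
  simp
  ring

lemma ut_sigma {N d : ℕ} (κ : ℝ) (hκ : 0 < κ) (Cov : Fin N → Matrix (Fin d) (Fin d) ℝ)
    (l : Fin N → Fin d → Fin d → ℝ)
    (hl : ∀ i, ∑ j, vecMulVec (l i j) (l i j) = ((N : ℝ) * d + κ) • Cov i)
    (a b c : ℝ) (o₁ o₂ o₃ : Option (Fin N × Fin d)) :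
    let D : Fin N → Fin d → Option (Fin N × Fin d) → ℝ :=
      fun i j => utDev fun p => if p.1 = i then l i j p.2 else 0
    (κ / (κ + (N : ℝ) * d)) * (a * b * c)
      + ∑ i, ∑ j, (1 / (2 * (κ + (N : ℝ) * d))) *
          ((a + D i j o₁) * (b + D i j o₂) * (c + D i j o₃)
            + (a - D i j o₁) * (b - D i j o₂) * (c - D i j o₃)) =
      a * b * c + a * utCov Cov o₂ o₃ + b * utCov Cov o₁ o₃ + c * utCov Cov o₁ o₂ := by
  intro D
  have hc : κ + (N : ℝ) * d ≠ 0 := by positivity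
  have e2 : ∀ o o', ∑ i, ∑ j, D i j o * D i j o' = (κ + (N : ℝ) * d) * utCov Cov o o' := by
    intro o o'
    rcases o with _ | p
    · simp [D, utDev, utCov]
    rcases o' with _ | q
    · simp [D, utDev, utCov]
    simp only [D, utDev, utCov]
    rw [Finset.sum_eq_single p.1]
    · by_cases h : p.1 = q.1
      · have := congrFun (congrFun (hl p.1) p.2) q.2
        simp only [Matrix.sum_apply, vecMulVec_apply, Matrix.smul_apply, smul_eq_mul] at this
        simp [h] at this ⊢
        rw [this]; ring
      · have h' : ¬ q.1 = p.1 := fun e => h e.symm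
        simp [h, h']
    · intro i _ hi
      simp [Ne.symm hi]
    · simp
  have : ∀ i j, (1 / (2 * (κ + (N : ℝ) * d))) *
          ((a + D i j o₁) * (b + D i j o₂) * (c + D i j o₃)
            + (a - D i j o₁) * (b - D i j o₂) * (c - D i j o₃)) =
      (1 / (κ + (N : ℝ) * d)) * (a * b * c + a * (D i j o₂ * D i j o₃)
        + b * (D i j o₁ * D i j o₃) + c * (D i j o₁ * D i j o₂)) := by
    intro i j
    field_simp
    ring
  simp_rw [this, ← Finset.mul_sum, Finset.sum_add_distrib, ← Finset.mul_sum, e2]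
  simp
  field_simp
  ring

/-- The unscented-transformation sigma-point quadrature with central weight `κ/(κ + Nd)` and
side weights `1/(2(κ + Nd))`, built from columns `lᵢʲ` satisfying
`∑ⱼ lᵢʲ (lᵢʲ)ᵀ = (Nd + κ) Covᵢ`, computes the exact Gaussian expectation
`E[g(Z₀ + δZ)]` for every polynomial function `g` of total degree at most 3, where the blocks
`δzᵢ = Lᵢ ξᵢ` of `δZ` are independent centered Gaussians with covariances `Covᵢ = Lᵢ Lᵢᵀ` and the
coordinates of the `ξᵢ` are i.i.d. standard normal. -/
theorem unscented_transform_exact_degree_three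
    (N d : ℕ) (hN : 1 ≤ N) (hd : 1 ≤ d) (κ : ℝ) (hκ : 0 < κ)
    (Z₀ : Fin N → Fin d → ℝ)
    (Cov : Fin N → Matrix (Fin d) (Fin d) ℝ)
    (hCovSymm : ∀ i, (Cov i)ᵀ = Cov i)
    (hCovPsd : ∀ i, ∀ x : Fin d → ℝ, 0 ≤ x ⬝ᵥ (Cov i).mulVec x)
    (l : Fin N → Fin d → Fin d → ℝ)
    (hl : ∀ i, ∑ j, vecMulVec (l i j) (l i j) = ((N : ℝ) * d + κ) • Cov i)
    (L : Fin N → Matrix (Fin d) (Fin d) ℝ)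
    (hL : ∀ i, L i * (L i)ᵀ = Cov i)
    (P : MvPolynomial (Fin N × Fin d) ℝ) (hP : P.totalDegree ≤ 3)
    (g : (Fin N → Fin d → ℝ) → ℝ)
    (hg : ∀ Z, g Z = MvPolynomial.eval (fun p => Z p.1 p.2) P) :
    (κ / (κ + (N : ℝ) * d)) * g Z₀
      + ∑ i, ∑ j, (1 / (2 * (κ + (N : ℝ) * d))) *
          (g (Function.update Z₀ i (Z₀ i + l i j))
            + g (Function.update Z₀ i (Z₀ i - l i j)))
      = ∫ ξ : Fin N → Fin d → ℝ,
          g (fun i => Z₀ i + (L i).mulVec (ξ i))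
          ∂(Measure.pi fun _ => Measure.pi fun _ => gaussianReal 0 1) := by
  classical
  obtain ⟨o, ho⟩ : ∃ o : (Fin N × Fin d →₀ ℕ) → Fin 3 → Option (Fin N × Fin d),
      ∀ s ∈ P.support, ∀ z x : Fin N × Fin d → ℝ,
      (s.prod fun n e => (z n + x n) ^ e) =
        (utCen z (o s 0) + utDev x (o s 0)) * (utCen z (o s 1) + utDev x (o s 1)) *
          (utCen z (o s 2) + utDev x (o s 2)) := by
    have : ∀ s : Fin N × Fin d →₀ ℕ, ∃ o : Fin 3 → Option (Fin N × Fin d), s ∈ P.support →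
      ∀ z x : Fin N × Fin d → ℝ,
      (s.prod fun n e => (z n + x n) ^ e) =
        (utCen z (o 0) + utDev x (o 0)) * (utCen z (o 1) + utDev x (o 1)) *
          (utCen z (o 2) + utDev x (o 2)) := by
      intro s
      by_cases hs : s ∈ P.support
      · obtain ⟨o₁, o₂, o₃, h⟩ := ut_monomial s ((MvPolynomial.le_totalDegree hs).trans hP)
        exact ⟨![o₁, o₂, o₃], fun _ => h⟩
      · exact ⟨fun _ => none, fun h => absurd h hs⟩
    choose o ho using this
    exact ⟨o, ho⟩
  set z : Fin N × Fin d → ℝ := fun p => Z₀ p.1 p.2 with hz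
  have hG : ∀ (Z : Fin N → Fin d → ℝ) (x : Fin N × Fin d → ℝ),
      (∀ p, Z p.1 p.2 = z p + x p) → g Z = ∑ s ∈ P.support, P.coeff s *
        ((utCen z (o s 0) + utDev x (o s 0)) * (utCen z (o s 1) + utDev x (o s 1)) *
          (utCen z (o s 2) + utDev x (o s 2))) := by
    intro Z x h
    rw [hg, MvPolynomial.eval_eq']
    refine Finset.sum_congr rfl fun s hs => ?_
    rw [← ho s hs, Finsupp.prod_fintype _ _ (by simp)]
    simp [h]
  have hdneg : ∀ (x : Fin N × Fin d → ℝ) q, utDev (fun p => - x p) q = - utDev x q := by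
    intro x q; cases q <;> simp [utDev]
  have hd0 : ∀ q : Option (Fin N × Fin d), utDev (fun _ => (0:ℝ)) q = 0 := by
    intro q; cases q <;> simp [utDev]
  have g0 := hG Z₀ (fun _ => 0) (by simp [hz])
  have gp : ∀ i j, _ := fun i j => hG (Function.update Z₀ i (Z₀ i + l i j))
    (fun p => if p.1 = i then l i j p.2 else 0) (by
      intro p
      by_cases h : p.1 = i
      · subst h; simp [hz]
      · simp [hz, h])
  have gm : ∀ i j, _ := fun i j => hG (Function.update Z₀ i (Z₀ i - l i j))
    (fun p => - if p.1 = i then l i j p.2 else 0) (by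
      intro p
      by_cases h : p.1 = i
      · subst h; simp [hz, sub_eq_add_neg]
      · simp [hz, h])
  have gi : ∀ ξ : Fin N → Fin d → ℝ, _ := fun ξ => hG (fun i => Z₀ i + (L i).mulVec (ξ i))
    (fun p => (L p.1).mulVec (ξ p.1) p.2) (by intro p; simp [hz])
  simp_rw [g0, gp, gm, gi, hdneg, hd0, add_zero, ← sub_eq_add_neg]
  have hE := fun s => ut_expect Cov L hL (utCen z (o s 0)) (utCen z (o s 1)) (utCen z (o s 2))
    (o s 0) (o s 1) (o s 2)
  have hS := fun s => ut_sigma κ hκ Cov l hl (utCen z (o s 0)) (utCen z (o s 1)) (utCen z (o s 2))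
    (o s 0) (o s 1) (o s 2)
  simp only at hE hS
  rw [integral_finsetSum _ fun s _ => (hE s).1.const_mul _]
  simp_rw [integral_const_mul]
  have hR := Finset.sum_congr (rfl : P.support = P.support) fun s _ =>
    congrArg (fun v => P.coeff s * v) ((hE s).2.trans (hS s).symm)
  refine Eq.trans ?_ hR.symm
  simp only [mul_add (P.coeff _), Finset.sum_add_distrib]
  congr 1
  · rw [Finset.mul_sum]
    exact Finset.sum_congr rfl fun s _ => by ring
  · simp_rw [← Finset.sum_add_distrib, Finset.mul_sum]
    rw [Finset.sum_comm' (t' := Finset.univ) (s' := fun _ => P.support) (by simp)]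
    refine Finset.sum_congr rfl fun i _ => ?_
    rw [Finset.sum_comm]
    refine Finset.sum_congr rfl fun j _ => ?_
    refine Finset.sum_congr rfl fun s _ => ?_
    ring
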